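/- Let Γ = [x_0,x_1] × [y_0,y_1] be a rectangle in ℂ (x_0 < x_1, y_0 < y_1) and let F ∈ ℂ[X,Y] be a polynomial in two real variables with F(x,y) ≠ 0 for all (x,y) ∈ Γ. Then ind_{∂Γ}(F) = 0. -/

import Mathlib

open Polynomial

/-- The value at `x` of the "unit part" of `P` after removing the factor `(X - x)^m`,
where `m` is the multiplicity of `x` as a root of `P`. Nonzero whenever `P ≠ 0`. -/
noncomputable def unitEval (P : Polynomial ℝ) (x : ℝ) : ℝ :=
  (P /ₘ (X - C x) ^ rootMultiplicity x P).eval x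

/-- One-sided Cauchy index `Ind_x^+` of the rational function `R/S` at `x`. -/
noncomputable def indPlus (R S : Polynomial ℝ) (x : ℝ) : ℝ :=
  if (rootMultiplicity x R : ℤ) < (rootMultiplicity x S : ℤ) then
    (1 / 2) * Real.sign (unitEval R x * unitEval S x)
  else 0

/-- One-sided Cauchy index `Ind_x^-` of the rational function `R/S` at `x`. -/
noncomputable def indMinus (R S : Polynomial ℝ) (x : ℝ) : ℝ :=
  if (rootMultiplicity x R : ℤ) < (rootMultiplicity x S : ℤ) then
    (1 / 2) * (-1 : ℝ) ^ (rootMultiplicity x S - rootMultiplicity x R) *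
      Real.sign (unitEval R x * unitEval S x)
  else 0

/-- Local Cauchy index `Ind_x(R/S) = Ind_x^+(R/S) - Ind_x^-(R/S)`. -/
noncomputable def indPoint (R S : Polynomial ℝ) (x : ℝ) : ℝ :=
  indPlus R S x - indMinus R S x

/-- The Cauchy index `Ind_a^b(R/S)` of the rational function `R/S` on `[a, b]`:
`Ind_a^+(R/S) + Σ_{x ∈ (a,b)} Ind_x(R/S) - Ind_b^-(R/S)`, with the convention that
it is `0` when `R = 0` or `S = 0`.  (Only poles, i.e. roots of `S`, contribute to
the middle sum.) -/
noncomputable def cauchyIndex (R S : Polynomial ℝ) (a b : ℝ) : ℝ :=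
  if R = 0 ∨ S = 0 then 0
  else indPlus R S a +
      (∑ x ∈ S.roots.toFinset, if a < x ∧ x < b then indPoint R S x else 0) -
      indMinus R S b

/-- Number of sign changes `V(s_0, …, s_n) = Σ ½|sign s_{k-1} - sign s_k|` of a list of reals. -/
noncomputable def signVar : List ℝ → ℝ
  | [] => 0
  | [_] => 0
  | a :: b :: l => (1 / 2) * |Real.sign a - Real.sign b| + signVar (b :: l)

/-- Sign changes `V_x(S_0, …, S_n)` of a list of real polynomials evaluated at `x`. -/
noncomputable def signVarAt (L : List (Polynomial ℝ)) (x : ℝ) : ℝ :=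
  signVar (L.map fun P => P.eval x)

/-- Real part of a complex polynomial, coefficientwise. -/
noncomputable def rePoly (p : Polynomial ℂ) : Polynomial ℝ :=
  p.sum fun n c => Polynomial.C c.re * Polynomial.X ^ n

/-- Imaginary part of a complex polynomial, coefficientwise. -/
noncomputable def imPoly (p : Polynomial ℂ) : Polynomial ℝ :=
  p.sum fun n c => Polynomial.C c.im * Polynomial.X ^ n

/-- For `F ∈ ℂ[X,Y]` (two real variables, identifying `ℂ` with `ℝ²`), the one-variable
polynomial `F̂ ∈ ℂ[T]` obtained by substituting the affine parametrization
`t ↦ a + t(b - a)` of the segment from `a` to `b`, i.e.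
`X ↦ re a + t(re b - re a)` and `Y ↦ im a + t(im b - im a)`. -/
noncomputable def segPolyXY (F : MvPolynomial (Fin 2) ℂ) (a b : ℂ) : Polynomial ℂ :=
  MvPolynomial.aeval (fun j : Fin 2 =>
    if j = 0 then Polynomial.C (a.re : ℂ) + Polynomial.C ((b.re - a.re : ℝ) : ℂ) * Polynomial.X
    else Polynomial.C (a.im : ℂ) + Polynomial.C ((b.im - a.im : ℝ) : ℂ) * Polynomial.X) F

/-- The index `ind_{[a,b]}(F) = ½ · Ind_0^1(re F̂ / im F̂)` of `F ∈ ℂ[X,Y]` along the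
segment from `a` to `b`. -/
noncomputable def segIndexXY (F : MvPolynomial (Fin 2) ℂ) (a b : ℂ) : ℝ :=
  (1 / 2) * cauchyIndex (rePoly (segPolyXY F a b)) (imPoly (segPolyXY F a b)) 0 1

/-- The algebraic index `ind_{∂Γ}(F)` of `F ∈ ℂ[X,Y]` along the positively oriented
boundary of the rectangle `Γ = [x₀,x₁] × [y₀,y₁] ⊂ ℂ`. -/
noncomputable def rectIndexXY (F : MvPolynomial (Fin 2) ℂ) (x₀ x₁ y₀ y₁ : ℝ) : ℝ :=
  segIndexXY F (x₀ + y₀ * Complex.I) (x₁ + y₀ * Complex.I) +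
  segIndexXY F (x₁ + y₀ * Complex.I) (x₁ + y₁ * Complex.I) +
  segIndexXY F (x₁ + y₁ * Complex.I) (x₀ + y₁ * Complex.I) +
  segIndexXY F (x₀ + y₁ * Complex.I) (x₀ + y₀ * Complex.I)

/-- Evaluation of `F ∈ ℂ[X,Y]` at a point `(x, y) ∈ ℝ²`. -/
noncomputable def evalXY (F : MvPolynomial (Fin 2) ℂ) (x y : ℝ) : ℂ :=
  MvPolynomial.eval (fun j : Fin 2 => if j = 0 then (x : ℂ) else (y : ℂ)) F

section UnitPart

lemma eval_eq_pow_mul_divByMonic (S : Polynomial ℝ) (x y : ℝ) :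
    S.eval y = (y - x) ^ rootMultiplicity x S *
      (S /ₘ (X - C x) ^ rootMultiplicity x S).eval y := by
  conv_lhs => rw [← pow_mul_divByMonic_rootMultiplicity_eq S x]
  simp

lemma unitEval_ne_zero {S : Polynomial ℝ} (hS : S ≠ 0) (x : ℝ) : unitEval S x ≠ 0 :=
  eval_divByMonic_pow_rootMultiplicity_ne_zero x hS

lemma unitEval_of_eval_ne_zero {S : Polynomial ℝ} {x : ℝ} (h : S.eval x ≠ 0) :
    unitEval S x = S.eval x := by
  simp [unitEval, rootMultiplicity_eq_zero (p := S) (x := x) h]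

lemma real_sign_mul (x y : ℝ) : Real.sign (x * y) = Real.sign x * Real.sign y := by
  rcases lt_trichotomy x 0 with hx | rfl | hx <;> rcases lt_trichotomy y 0 with hy | rfl | hy <;>
    simp [Real.sign_of_neg, Real.sign_of_pos, mul_pos_of_neg_of_neg, mul_neg_of_neg_of_pos,
      mul_neg_of_pos_of_neg, *]

/-- A polynomial without zeros on an interval has constant sign there. -/
lemma sign_eval_eq_of_ne_zero {P : Polynomial ℝ} {s : Set ℝ} (hs : s.OrdConnected)
    (h : ∀ x ∈ s, P.eval x ≠ 0) {x y : ℝ} (hx : x ∈ s) (hy : y ∈ s) :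
    Real.sign (P.eval x) = Real.sign (P.eval y) := by
  by_contra hne
  have hc : ContinuousOn (fun z => P.eval z) s := P.continuous.continuousOn
  have key : (0 : ℝ) ∈ (fun z => P.eval z) '' s := by
    rcases lt_or_gt_of_ne (h x hx) with h1 | h1 <;> rcases lt_or_gt_of_ne (h y hy) with h2 | h2
    · simp [Real.sign_of_neg, h1, h2] at hne
    · exact hs.isPreconnected.intermediate_value hx hy hc ⟨h1.le, h2.le⟩
    · exact hs.isPreconnected.intermediate_value hy hx hc ⟨h2.le, h1.le⟩
    · simp [Real.sign_of_pos, h1, h2] at hne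
  obtain ⟨z, hz, hz0⟩ := key
  exact h z hz hz0

/-- The sign of `S` just to the right of `a` is the sign of its unit part at `a`. -/
lemma sign_unitEval_of_right {S : Polynomial ℝ} (hS : S ≠ 0) {a c : ℝ} (hac : a < c)
    (h : ∀ x ∈ Set.Ioc a c, S.eval x ≠ 0) : Real.sign (unitEval S a) = Real.sign (S.eval c) := by
  rw [eval_eq_pow_mul_divByMonic S a c, real_sign_mul,
    Real.sign_of_pos (pow_pos (sub_pos.2 hac) _), one_mul]
  refine sign_eval_eq_of_ne_zero Set.ordConnected_Icc (fun x hx => ?_)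
    (Set.left_mem_Icc.2 hac.le) (Set.right_mem_Icc.2 hac.le)
  rcases hx.1.eq_or_lt with rfl | hlt
  · exact unitEval_ne_zero hS a
  · have := h x ⟨hlt, hx.2⟩
    rw [eval_eq_pow_mul_divByMonic S a x] at this
    exact right_ne_zero_of_mul this

/-- The sign of `S` just to the left of `b`, in terms of its unit part at `b`. -/
lemma sign_unitEval_of_left {S : Polynomial ℝ} (hS : S ≠ 0) {b c : ℝ} (hcb : c < b)
    (h : ∀ x ∈ Set.Ico c b, S.eval x ≠ 0) :
    (-1) ^ rootMultiplicity b S * Real.sign (unitEval S b) = Real.sign (S.eval c) := by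
  have hpow : Real.sign ((c - b) ^ rootMultiplicity b S) = (-1) ^ rootMultiplicity b S := by
    induction rootMultiplicity b S with
    | zero => simp
    | succ n ih => rw [pow_succ, real_sign_mul, ih, Real.sign_of_neg (sub_neg.2 hcb), pow_succ]
  rw [eval_eq_pow_mul_divByMonic S b c, real_sign_mul, hpow]
  congr 1
  refine sign_eval_eq_of_ne_zero Set.ordConnected_Icc (fun x hx => ?_)
    (Set.right_mem_Icc.2 hcb.le) (Set.left_mem_Icc.2 hcb.le)
  rcases hx.2.eq_or_lt with rfl | hlt
  · exact unitEval_ne_zero hS _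
  · have := h x ⟨hx.1, hlt⟩
    rw [eval_eq_pow_mul_divByMonic S b x] at this
    exact right_ne_zero_of_mul this

end UnitPart

section CauchyIndex

variable {R S : Polynomial ℝ}

lemma indPlus_eq_zero {x : ℝ} (h : S.eval x ≠ 0) : indPlus R S x = 0 := by
  simp [indPlus, rootMultiplicity_eq_zero (p := S) (x := x) h]

lemma indMinus_eq_zero {x : ℝ} (h : S.eval x ≠ 0) : indMinus R S x = 0 := by
  simp [indMinus, rootMultiplicity_eq_zero (p := S) (x := x) h]

lemma indPoint_eq_zero {x : ℝ} (h : S.eval x ≠ 0) : indPoint R S x = 0 := by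
  simp [indPoint, indPlus_eq_zero h, indMinus_eq_zero h]

lemma indPlus_of_eval_ne_zero (hS : S ≠ 0) {x : ℝ} (h : R.eval x ≠ 0) :
    indPlus R S x =
      1 / 2 * Real.sign (R.eval x) * (Real.sign (unitEval S x) - Real.sign (S.eval x)) := by
  by_cases hx : S.eval x = 0
  · have : 0 < rootMultiplicity x S := (rootMultiplicity_pos hS).2 hx
    rw [indPlus, rootMultiplicity_eq_zero (p := R) (x := x) h, if_pos (by exact_mod_cast this),
      unitEval_of_eval_ne_zero h, real_sign_mul, hx, Real.sign_zero]
    ring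
  · rw [indPlus_eq_zero hx, unitEval_of_eval_ne_zero hx]
    ring

lemma indMinus_of_eval_ne_zero (hS : S ≠ 0) {x : ℝ} (h : R.eval x ≠ 0) :
    indMinus R S x = 1 / 2 * Real.sign (R.eval x) *
      ((-1) ^ rootMultiplicity x S * Real.sign (unitEval S x) - Real.sign (S.eval x)) := by
  by_cases hx : S.eval x = 0
  · have : 0 < rootMultiplicity x S := (rootMultiplicity_pos hS).2 hx
    rw [indMinus, rootMultiplicity_eq_zero (p := R) (x := x) h, if_pos (by exact_mod_cast this),
      unitEval_of_eval_ne_zero h, real_sign_mul, hx, Real.sign_zero, Nat.sub_zero]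
    ring
  · rw [indMinus_eq_zero hx, unitEval_of_eval_ne_zero hx,
      rootMultiplicity_eq_zero (p := S) (x := x) hx]
    ring

lemma cauchyIndex_add (R S : Polynomial ℝ) {a b c : ℝ} (hab : a < b) (hbc : b < c) :
    cauchyIndex R S a b + cauchyIndex R S b c = cauchyIndex R S a c := by
  unfold cauchyIndex
  split_ifs with h
  · simp
  push Not at h
  have hsum : ∀ x ∈ S.roots.toFinset, (if a < x ∧ x < c then indPoint R S x else 0) =
      (if a < x ∧ x < b then indPoint R S x else 0) +
      (if b < x ∧ x < c then indPoint R S x else 0) + (if x = b then indPoint R S x else 0) := by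
    intro x _
    rcases lt_trichotomy x b with hx | rfl | hx
    · simp [hx, hx.not_gt, hx.ne, hx.trans hbc]
    · simp [hab, hbc]
    · simp [hx, hx.not_gt, hx.ne', hab.trans hx]
  have hb : (if b ∈ S.roots.toFinset then indPoint R S b else 0) = indPoint R S b := by
    split_ifs with hb
    · rfl
    · rw [indPoint_eq_zero]
      simpa [h.2] using hb
  rw [Finset.sum_congr rfl hsum, Finset.sum_add_distrib, Finset.sum_add_distrib,
    Finset.sum_ite_eq', hb, indPoint]
  ring

lemma cauchyIndex_eq_sum (R S : Polynomial ℝ) {u : ℕ → ℝ} (hu : StrictMono u) (n : ℕ) :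
    cauchyIndex R S (u 0) (u (n + 1)) =
      ∑ k ∈ Finset.range (n + 1), cauchyIndex R S (u k) (u (k + 1)) := by
  induction n with
  | zero => simp
  | succ n ih =>
    rw [Finset.sum_range_succ, ← ih, cauchyIndex_add R S (hu n.succ_pos) (hu (Nat.lt_succ_self _))]

lemma cauchyIndex_of_den_ne_zero {a b : ℝ} (hab : a ≤ b) (h : ∀ x ∈ Set.Icc a b, S.eval x ≠ 0) :
    cauchyIndex R S a b = 0 := by
  unfold cauchyIndex
  split_ifs with h0
  · rfl
  rw [indPlus_eq_zero (h a (Set.left_mem_Icc.2 hab)),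
    indMinus_eq_zero (h b (Set.right_mem_Icc.2 hab)), Finset.sum_eq_zero]
  · simp
  · intro x _
    split_ifs with hx
    · exact indPoint_eq_zero (h x ⟨hx.1.le, hx.2.le⟩)
    · rfl

lemma cauchyIndex_of_den_ne_zero_Ioo (hS : S ≠ 0) {a b s : ℝ} (hab : a < b) (hs : s ≠ 0)
    (hR : ∀ x ∈ Set.Icc a b, Real.sign (R.eval x) = s) (h : ∀ x ∈ Set.Ioo a b, S.eval x ≠ 0) :
    cauchyIndex R S a b = 1 / 2 * s * (Real.sign (S.eval b) - Real.sign (S.eval a)) := by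
  have hR0 : ∀ x ∈ Set.Icc a b, R.eval x ≠ 0 := fun x hx h0 => hs (by rw [← hR x hx, h0]; simp)
  have ha := Set.left_mem_Icc.2 hab.le
  have hb := Set.right_mem_Icc.2 hab.le
  have hRne : R ≠ 0 := fun h0 => hR0 a ha (by simp [h0])
  obtain ⟨c, hac, hcb⟩ := exists_between hab
  rw [cauchyIndex, if_neg (by simp [hRne, hS]), indPlus_of_eval_ne_zero hS (hR0 a ha),
    indMinus_of_eval_ne_zero hS (hR0 b hb), hR a ha, hR b hb, Finset.sum_eq_zero,
    sign_unitEval_of_right hS hac (fun x hx => h x ⟨hx.1, hx.2.trans_lt hcb⟩),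
    sign_unitEval_of_left hS hcb (fun x hx => h x ⟨hac.trans_le hx.1, hx.2⟩)]
  · ring
  · intro x _
    split_ifs with hx
    · exact indPoint_eq_zero (h x hx)
    · rfl

/-- The Cauchy index of `R / S` on an interval where `R` has constant nonzero sign. -/
lemma cauchyIndex_of_num_sign {a b s : ℝ} (hab : a < b) (hs : s ≠ 0)
    (hR : ∀ x ∈ Set.Icc a b, Real.sign (R.eval x) = s) :
    cauchyIndex R S a b = 1 / 2 * s * (Real.sign (S.eval b) - Real.sign (S.eval a)) := by
  by_cases hS : S = 0
  · simp [cauchyIndex, hS]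
  induction hn : {x ∈ S.roots.toFinset | a < x ∧ x < b}.card using Nat.strong_induction_on
    generalizing a b with
  | _ n ih =>
    by_cases h : ∀ x ∈ Set.Ioo a b, S.eval x ≠ 0
    · exact cauchyIndex_of_den_ne_zero_Ioo hS hab hs hR h
    push Not at h
    obtain ⟨c, ⟨hac, hcb⟩, hc⟩ := h
    have hmem : c ∈ {x ∈ S.roots.toFinset | a < x ∧ x < b} := by simp [hS, hc, hac, hcb]
    rw [← cauchyIndex_add R S hac hcb,
      ih _ ?_ hac (fun x hx => hR x ⟨hx.1, hx.2.trans hcb.le⟩) rfl,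
      ih _ ?_ hcb (fun x hx => hR x ⟨hac.le.trans hx.1, hx.2⟩) rfl]
    · ring
    all_goals
      rw [← hn]
      refine Finset.card_lt_card ((Finset.ssubset_iff_of_subset fun x hx => ?_).2
        ⟨c, hmem, by simp⟩)
      simp only [Finset.mem_filter] at hx ⊢
    · exact ⟨hx.1, hac.trans hx.2.1, hx.2.2⟩
    · exact ⟨hx.1, hx.2.1, hx.2.2.trans hcb⟩

end CauchyIndex

section Crossing

/-- A set of complex numbers contained in one of the four open half planes bounded by the
real or the imaginary axis. -/
def InHalfPlane (A : Set ℂ) : Prop :=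
  (∃ s : ℝ, s ≠ 0 ∧ ∀ z ∈ A, Real.sign z.re = s) ∨ ∃ s : ℝ, s ≠ 0 ∧ ∀ z ∈ A, Real.sign z.im = s

lemma InHalfPlane.mono {A B : Set ℂ} (hB : InHalfPlane B) (h : A ⊆ B) : InHalfPlane A :=
  hB.imp (fun ⟨s, hs, H⟩ => ⟨s, hs, fun z hz => H z (h hz)⟩)
    (fun ⟨s, hs, H⟩ => ⟨s, hs, fun z hz => H z (h hz)⟩)

/-- The contribution to the Cauchy index of `re / im` of a path from `z` to `w` that stays
inside one of the four half planes. -/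
noncomputable def crossing (z w : ℂ) : ℝ :=
  1 / 4 * (Real.sign z.re + Real.sign w.re) * (Real.sign w.im - Real.sign z.im)

lemma crossing_swap (z w : ℂ) : crossing w z = -crossing z w := by
  unfold crossing
  ring

lemma crossing_cycle {A : Set ℂ} (hA : InHalfPlane A) {p q r s : ℂ}
    (hp : p ∈ A) (hq : q ∈ A) (hr : r ∈ A) (hs : s ∈ A) :
    crossing p q + crossing q r + crossing r s + crossing s p = 0 := by
  unfold crossing
  rcases hA with ⟨σ, -, H⟩ | ⟨σ, -, H⟩ <;> rw [H p hp, H q hq, H r hr, H s hs] <;> ring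

lemma cauchyIndex_eq_crossing {R S : Polynomial ℝ} {G : ℝ → ℂ} (hR : ∀ t, R.eval t = (G t).re)
    (hS : ∀ t, S.eval t = (G t).im) {a b : ℝ} (hab : a < b) (h : InHalfPlane (G '' Set.Icc a b)) :
    cauchyIndex R S a b = crossing (G a) (G b) := by
  have ha := Set.mem_image_of_mem G (Set.left_mem_Icc.2 hab.le)
  have hb := Set.mem_image_of_mem G (Set.right_mem_Icc.2 hab.le)
  unfold crossing
  rcases h with ⟨s, hs, H⟩ | ⟨s, hs, H⟩
  · rw [cauchyIndex_of_num_sign hab hs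
      (fun x hx => by rw [hR]; exact H _ (Set.mem_image_of_mem G hx)), H _ ha, H _ hb, hS, hS]
    ring
  · rw [cauchyIndex_of_den_ne_zero hab.le, H _ ha, H _ hb]
    · ring
    · intro x hx h0
      apply hs
      rw [← H _ (Set.mem_image_of_mem G hx), ← hS, h0, Real.sign_zero]

/-- Summing the contributions of the cells of a grid leaves only the boundary edges. -/
lemma sum_crossing_grid (f : ℕ → ℕ → ℂ) (N : ℕ)
    (h : ∀ i < N, ∀ j < N, crossing (f i j) (f (i + 1) j) +
      crossing (f (i + 1) j) (f (i + 1) (j + 1)) + crossing (f (i + 1) (j + 1)) (f i (j + 1)) +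
      crossing (f i (j + 1)) (f i j) = 0) :
    ∑ i ∈ Finset.range N, crossing (f i 0) (f (i + 1) 0) +
      ∑ j ∈ Finset.range N, crossing (f N j) (f N (j + 1)) -
      ∑ i ∈ Finset.range N, crossing (f i N) (f (i + 1) N) -
      ∑ j ∈ Finset.range N, crossing (f 0 j) (f 0 (j + 1)) = 0 := by
  have hh (i : ℕ) := Finset.sum_range_sub (fun j => crossing (f i j) (f (i + 1) j)) N
  have hv (j : ℕ) := Finset.sum_range_sub (fun i => crossing (f i j) (f i (j + 1))) N
  have hcells : ∑ i ∈ Finset.range N, ∑ j ∈ Finset.range N,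
      ((crossing (f (i + 1) j) (f (i + 1) (j + 1)) - crossing (f i j) (f i (j + 1))) -
      (crossing (f i (j + 1)) (f (i + 1) (j + 1)) - crossing (f i j) (f (i + 1) j))) = 0 := by
    refine Finset.sum_eq_zero fun i hi => Finset.sum_eq_zero fun j hj => ?_
    have := h i (Finset.mem_range.1 hi) j (Finset.mem_range.1 hj)
    rw [crossing_swap (f i (j + 1)) (f (i + 1) (j + 1)), crossing_swap (f i j) (f i (j + 1))] at this
    linarith
  simp only [Finset.sum_sub_distrib] at hcells hh hv
  rw [Finset.sum_comm (f := fun i j => crossing (f (i + 1) j) (f (i + 1) (j + 1))),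
    Finset.sum_comm (f := fun i j => crossing (f i j) (f i (j + 1)))] at hcells
  have h1 := Finset.sum_congr (rfl : Finset.range N = _) fun i _ => hh i
  have h2 := Finset.sum_congr (rfl : Finset.range N = _) fun j _ => hv j
  simp only [Finset.sum_sub_distrib] at h1 h2
  linarith

lemma sum_crossing_reverse (f : ℕ → ℂ) (N : ℕ) :
    ∑ k ∈ Finset.range N, crossing (f (N - k)) (f (N - (k + 1))) =
      -∑ k ∈ Finset.range N, crossing (f k) (f (k + 1)) := by
  rw [← Finset.sum_range_reflect, ← Finset.sum_neg_distrib]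
  refine Finset.sum_congr rfl fun k hk => ?_
  have := Finset.mem_range.1 hk
  rw [crossing_swap, show N - (N - 1 - k) = k + 1 by omega,
    show N - (N - 1 - k + 1) = k by omega]

end Crossing

section Segments

lemma eval_rePoly (p : Polynomial ℂ) (t : ℝ) : (rePoly p).eval t = (p.eval (t : ℂ)).re := by
  rw [rePoly, Polynomial.sum, eval_finsetSum, eval_eq_sum, Polynomial.sum, Complex.re_sum]
  refine Finset.sum_congr rfl fun n _ => ?_
  rw [← Complex.ofReal_pow, Complex.re_mul_ofReal]
  simp

lemma eval_imPoly (p : Polynomial ℂ) (t : ℝ) : (imPoly p).eval t = (p.eval (t : ℂ)).im := by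
  rw [imPoly, Polynomial.sum, eval_finsetSum, eval_eq_sum, Polynomial.sum, Complex.im_sum]
  refine Finset.sum_congr rfl fun n _ => ?_
  rw [← Complex.ofReal_pow, Complex.im_mul_ofReal]
  simp

lemma eval_segPolyXY (F : MvPolynomial (Fin 2) ℂ) (a b : ℂ) (t : ℝ) :
    (segPolyXY F a b).eval (t : ℂ) =
      evalXY F (a.re + t * (b.re - a.re)) (a.im + t * (b.im - a.im)) := by
  have h := MvPolynomial.map_aeval (R := ℂ) (fun j : Fin 2 =>
    if j = 0 then Polynomial.C (a.re : ℂ) + Polynomial.C ((b.re - a.re : ℝ) : ℂ) * Polynomial.X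
    else Polynomial.C (a.im : ℂ) + Polynomial.C ((b.im - a.im : ℝ) : ℂ) * Polynomial.X)
    (Polynomial.evalRingHom (t : ℂ)) F
  rw [Polynomial.coe_evalRingHom] at h
  rw [segPolyXY, h, evalXY, MvPolynomial.eval, MvPolynomial.coe_eval₂Hom,
    MvPolynomial.coe_eval₂Hom]
  congr 1
  · ext z
    simp
  · funext j
    split_ifs <;> simp [mul_comm]

lemma continuous_evalXY (F : MvPolynomial (Fin 2) ℂ) :
    Continuous fun p : ℝ × ℝ => evalXY F p.1 p.2 := by
  unfold evalXY
  refine (MvPolynomial.continuous_eval F).comp (continuous_pi fun j => ?_)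
  split_ifs <;> fun_prop

lemma segIndexXY_eq_sum_crossing (F : MvPolynomial (Fin 2) ℂ) (a b : ℂ) {G : ℝ → ℂ}
    (hG : ∀ t : ℝ, evalXY F (a.re + t * (b.re - a.re)) (a.im + t * (b.im - a.im)) = G t)
    {N : ℕ} (hN : 0 < N)
    (h : ∀ k < N, InHalfPlane (G '' Set.Icc ((k : ℝ) / N) (((k + 1 : ℕ) : ℝ) / N))) :
    segIndexXY F a b = 1 / 2 *
      ∑ k ∈ Finset.range N, crossing (G ((k : ℝ) / N)) (G (((k + 1 : ℕ) : ℝ) / N)) := by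
  have hN' : (0 : ℝ) < N := by exact_mod_cast hN
  have hu : StrictMono fun k : ℕ => (k : ℝ) / N := fun i j hij => by
    have : (i : ℝ) < j := by exact_mod_cast hij
    dsimp only
    gcongr
  obtain ⟨n, rfl⟩ := Nat.exists_eq_add_of_lt hN
  rw [zero_add] at *
  have := cauchyIndex_eq_sum (rePoly (segPolyXY F a b)) (imPoly (segPolyXY F a b)) hu n
  simp only [Nat.cast_zero, zero_div, div_self hN'.ne'] at this
  rw [segIndexXY, this]
  congr 1
  refine Finset.sum_congr rfl fun k hk => ?_
  exact cauchyIndex_eq_crossing (fun t => by rw [eval_rePoly, eval_segPolyXY, hG])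
    (fun t => by rw [eval_imPoly, eval_segPolyXY, hG]) (hu (Nat.lt_succ_self k))
    (h k (Finset.mem_range.1 hk))

end Segments

/-- A continuous nonvanishing function on a compact set maps all sufficiently small balls
into half planes. -/
lemma exists_inHalfPlane_closedBall {α : Type*} [PseudoMetricSpace α] {f : α → ℂ} {K : Set α}
    (hK : IsCompact K) (hf : Continuous f) (h : ∀ p ∈ K, f p ≠ 0) :
    ∃ N : ℕ, 0 < N ∧ ∀ p ∈ K, InHalfPlane (f '' Metric.closedBall p (1 / (N : ℝ))) := by
  have hre := Complex.continuous_re.comp hf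
  have him := Complex.continuous_im.comp hf
  obtain ⟨δ, hδ, H⟩ := lebesgue_number_lemma_of_metric
    (c := fun i : Bool × Bool => match i with
      | (true, true) => {p | 0 < (f p).re}
      | (true, false) => {p | (f p).re < 0}
      | (false, true) => {p | 0 < (f p).im}
      | (false, false) => {p | (f p).im < 0}) hK
    (by
      rintro ⟨_ | _, _ | _⟩
      exacts [isOpen_lt him continuous_const, isOpen_lt continuous_const him,
        isOpen_lt hre continuous_const, isOpen_lt continuous_const hre])
    (by
      intro p hp
      simp only [Set.mem_iUnion, Prod.exists, Bool.exists_bool, Set.mem_ofPred_eq]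
      by_contra! hcon
      exact h p hp (Complex.ext (le_antisymm hcon.2.2 hcon.2.1)
        (le_antisymm hcon.1.2 hcon.1.1)))
  obtain ⟨n, hn⟩ := exists_nat_one_div_lt hδ
  refine ⟨n + 1, n.succ_pos, fun p hp => ?_⟩
  obtain ⟨i, hi⟩ := H p hp
  have hsub := (Metric.closedBall_subset_ball (x := p) hn).trans hi
  rcases i with ⟨_ | _, _ | _⟩
  · exact Or.inr ⟨-1, by norm_num, by
      rintro _ ⟨q, hq, rfl⟩; exact Real.sign_of_neg (hsub (by exact_mod_cast hq))⟩
  · exact Or.inr ⟨1, by norm_num, by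
      rintro _ ⟨q, hq, rfl⟩; exact Real.sign_of_pos (hsub (by exact_mod_cast hq))⟩
  · exact Or.inl ⟨-1, by norm_num, by
      rintro _ ⟨q, hq, rfl⟩; exact Real.sign_of_neg (hsub (by exact_mod_cast hq))⟩
  · exact Or.inl ⟨1, by norm_num, by
      rintro _ ⟨q, hq, rfl⟩; exact Real.sign_of_pos (hsub (by exact_mod_cast hq))⟩

/-- Global version: if `F ∈ ℂ[X,Y]` does not vanish anywhere on the rectangle
`Γ = [x₀,x₁] × [y₀,y₁]`, then `ind_{∂Γ}(F) = 0`. -/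
theorem rectIndex_eq_zero_global (F : MvPolynomial (Fin 2) ℂ)
    (x₀ x₁ y₀ y₁ : ℝ) (hx : x₀ < x₁) (hy : y₀ < y₁)
    (hF : ∀ x ∈ Set.Icc x₀ x₁, ∀ y ∈ Set.Icc y₀ y₁, evalXY F x y ≠ 0) :
    rectIndexXY F x₀ x₁ y₀ y₁ = 0 := by
  set Φ : ℝ × ℝ → ℂ := fun p => evalXY F (x₀ + p.1 * (x₁ - x₀)) (y₀ + p.2 * (y₁ - y₀)) with hΦ
  have hcont : Continuous Φ := (continuous_evalXY F).comp
    (f := fun p : ℝ × ℝ => (x₀ + p.1 * (x₁ - x₀), y₀ + p.2 * (y₁ - y₀))) (by fun_prop)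
  have hne : ∀ p ∈ Set.Icc (0 : ℝ) 1 ×ˢ Set.Icc (0 : ℝ) 1, Φ p ≠ 0 := by
    rintro ⟨s, t⟩ ⟨⟨hs0, hs1⟩, ht0, ht1⟩
    dsimp only at hs0 hs1 ht0 ht1
    exact hF _ ⟨by nlinarith, by nlinarith⟩ _ ⟨by nlinarith, by nlinarith⟩
  obtain ⟨N, hN, H⟩ := exists_inHalfPlane_closedBall (isCompact_Icc.prod isCompact_Icc) hcont hne
  have hN' : (0 : ℝ) < N := by exact_mod_cast hN
  have hgrid : ∀ k ≤ N, (k : ℝ) / N ∈ Set.Icc (0 : ℝ) 1 := fun k hk =>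
    ⟨by positivity, (div_le_one hN').2 (by exact_mod_cast hk)⟩
  have hdist : ∀ k : ℕ, ∀ t ∈ Set.Icc ((k : ℝ) / N) (((k + 1 : ℕ) : ℝ) / N),
      |t - k / N| ≤ 1 / N := by
    rintro k t ⟨h1, h2⟩
    rw [Nat.cast_succ, add_div] at h2
    rw [abs_le]
    constructor <;> linarith
  have hsucc : ∀ k : ℕ, |((k + 1 : ℕ) : ℝ) / N - k / N| ≤ 1 / N := fun k =>
    hdist k _ ⟨by gcongr; simp, le_rfl⟩
  have hpath : ∀ γ : ℝ → ℝ × ℝ, (∀ t ∈ Set.Icc (0 : ℝ) 1, γ t ∈ Set.Icc 0 1 ×ˢ Set.Icc 0 1) →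
      (∀ s t, dist (γ s) (γ t) ≤ |s - t|) → ∀ k < N,
      InHalfPlane ((fun t => Φ (γ t)) '' Set.Icc ((k : ℝ) / N) (((k + 1 : ℕ) : ℝ) / N)) := by
    intro γ hγ hγd k hk
    refine (H _ (hγ _ (hgrid k hk.le))).mono ?_
    rintro _ ⟨t, ht, rfl⟩
    exact Set.mem_image_of_mem Φ ((hγd _ _).trans (hdist k t ht))
  have hrev : ∀ k ≤ N, (1 : ℝ) - k / N = ((N - k : ℕ) : ℝ) / N := fun k hk => by
    rw [Nat.cast_sub hk, sub_div, div_self hN'.ne']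
  have hself : (N : ℝ) / N = 1 := div_self hN'.ne'
  set f : ℕ → ℕ → ℂ := fun i j => Φ ((i : ℝ) / N, (j : ℝ) / N) with hf
  have bottom : segIndexXY F (x₀ + y₀ * Complex.I) (x₁ + y₀ * Complex.I) =
      1 / 2 * ∑ k ∈ Finset.range N, crossing (f k 0) (f (k + 1) 0) := by
    rw [segIndexXY_eq_sum_crossing F _ _ (G := fun t => Φ (t, 0)) _ hN
      (hpath (fun t => (t, 0)) (by simp) (by simp [Prod.dist_eq, Real.dist_eq]))]
    · simp [hf]
    · intro t
      simp [hΦ]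
  have right : segIndexXY F (x₁ + y₀ * Complex.I) (x₁ + y₁ * Complex.I) =
      1 / 2 * ∑ k ∈ Finset.range N, crossing (f N k) (f N (k + 1)) := by
    rw [segIndexXY_eq_sum_crossing F _ _ (G := fun t => Φ (1, t)) _ hN
      (hpath (fun t => (1, t)) (by simp) (by simp [Prod.dist_eq, Real.dist_eq]))]
    · simp [hf, hself]
    · intro t
      simp [hΦ]
  have top : segIndexXY F (x₁ + y₁ * Complex.I) (x₀ + y₁ * Complex.I) =
      1 / 2 * -∑ k ∈ Finset.range N, crossing (f k N) (f (k + 1) N) := by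
    rw [segIndexXY_eq_sum_crossing F _ _ (G := fun t => Φ (1 - t, 1)) _ hN
      (hpath (fun t => (1 - t, 1)) (by simp +contextual)
        (fun s t => by simp only [Prod.dist_eq, dist_self, dist_sub_left]; simp [Real.dist_eq])),
      ← sum_crossing_reverse (fun k => f k N)]
    · congr 1
      refine Finset.sum_congr rfl fun k hk => ?_
      rw [hrev k (Finset.mem_range.1 hk).le, hrev (k + 1) (Finset.mem_range.1 hk)]
      simp only [hf, hself]
    · intro t
      simp only [hΦ]
      congr 1 <;> simp <;> ring
  have left : segIndexXY F (x₀ + y₁ * Complex.I) (x₀ + y₀ * Complex.I) =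
      1 / 2 * -∑ k ∈ Finset.range N, crossing (f 0 k) (f 0 (k + 1)) := by
    rw [segIndexXY_eq_sum_crossing F _ _ (G := fun t => Φ (0, 1 - t)) _ hN
      (hpath (fun t => (0, 1 - t)) (by simp +contextual)
        (fun s t => by simp only [Prod.dist_eq, dist_self, dist_sub_left]; simp [Real.dist_eq])),
      ← sum_crossing_reverse (fun k => f 0 k)]
    · congr 1
      refine Finset.sum_congr rfl fun k hk => ?_
      rw [hrev k (Finset.mem_range.1 hk).le, hrev (k + 1) (Finset.mem_range.1 hk)]
      simp [hf]
    · intro t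
      simp only [hΦ]
      congr 1 <;> simp <;> ring
  have key := sum_crossing_grid f N fun i hi j hj => by
    have hmem : ∀ s t : ℝ, |s - i / N| ≤ 1 / N → |t - j / N| ≤ 1 / N →
        Φ (s, t) ∈ Φ '' Metric.closedBall ((i : ℝ) / N, (j : ℝ) / N) (1 / (N : ℝ)) :=
      fun s t hs ht => Set.mem_image_of_mem Φ (max_le hs ht)
    have h0 : ∀ x : ℝ, |x - x| ≤ 1 / N := fun x => by simp
    exact crossing_cycle (H _ ⟨hgrid i hi.le, hgrid j hj.le⟩) (hmem _ _ (h0 _) (h0 _))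
      (hmem _ _ (hsucc i) (h0 _)) (hmem _ _ (hsucc i) (hsucc j)) (hmem _ _ (h0 _) (hsucc j))
  rw [rectIndexXY, bottom, right, top, left]
  linarith
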